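/- Let μ ⊢ n and write μ̃ = (μ_2, μ_3, …) ⊢ n − μ_1. Then T_{w_μ} y_{μ′} ∈ Γ_{μ_1}(T_{w_{μ̃}} y_{μ̃′}) H_n, where T_{w_{μ̃}} y_{μ̃′} is computed in H_{n−μ_1} (with w_{μ̃} ∈ S_{n−μ_1} and μ̃′ the conjugate of μ̃); that is, T_{w_μ} y_{μ′} = Γ_{μ_1}(T_{w_{μ̃}} y_{μ̃′}) · h for some h ∈ H_n. -/

import Mathlib

open scoped Classical

noncomputable section

namespace FayersSemistd

/-- The value at `q` of the Gaussian (quantum) binomial coefficient polynomial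
`[a choose b]`, defined via the `q`-Pascal recurrence. -/
def qBinom {F : Type*} [Field F] (q : F) : ℕ → ℕ → F
  | _, 0 => 1
  | 0, _+1 => 0
  | a+1, b+1 => qBinom q a b + q ^ (b+1) * qBinom q a (b+1)

/-- `∏_i [A_i + B_i choose A_i]_q`, where `A_i`, `B_i` are multiplicities in the
multisets `A` and `B`. -/
def qBinomProd {F : Type*} [Field F] (q : F) (A B : Multiset ℕ) : F :=
  ∏ i ∈ (A + B).toFinset, qBinom q ((A + B).count i) (A.count i)

/-- `∑_{i<j} A_j * B_i` : the number of pairs `(x,y)` with `x ∈ A`, `y ∈ B`, `y < x`,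
counted with multiplicity. -/
def invPairs (A B : Multiset ℕ) : ℕ :=
  ((A.product B).filter (fun p => p.2 < p.1)).card

/-- The Coxeter length of a permutation of `{0,…,n-1}`: its number of inversions. -/
def permLength {n : ℕ} (w : Equiv.Perm (Fin n)) : ℕ :=
  (Finset.univ.filter (fun p : Fin n × Fin n => p.1 < p.2 ∧ w p.2 < w p.1)).card

/-- `λ_0 + ⋯ + λ_{r-1}`. -/
def cumSum (lam : ℕ → ℕ) (r : ℕ) : ℕ := ∑ i ∈ Finset.range r, lam i

/-- The (0-indexed) row of the diagram of `λ` containing the (0-indexed) position `p`,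
when positions are listed row by row. -/
def rowOf (lam : ℕ → ℕ) (p : ℕ) : ℕ := sInf {r | p < cumSum lam (r+1)}

/-- `λ` is a composition of `n`: finitely many nonzero parts, summing to `n`. -/
def IsComposition (n : ℕ) (lam : ℕ → ℕ) : Prop :=
  ∃ N, (∀ r, N ≤ r → lam r = 0) ∧ cumSum lam N = n

/-- `μ` is a partition of `n`. -/
def IsPartition (n : ℕ) (mu : ℕ → ℕ) : Prop := IsComposition n mu ∧ Antitone mu

/-- The conjugate partition (0-indexed): `conjP μ i = #{r | μ r > i}`. -/
def conjP (mu : ℕ → ℕ) (i : ℕ) : ℕ := sInf {r | mu r ≤ i}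

/-- The standard Young subgroup `W_λ` of `S_n` (as a set): the permutations preserving
each consecutive block of sizes `λ_0, λ_1, …`. -/
def youngW {n : ℕ} (lam : ℕ → ℕ) : Set (Equiv.Perm (Fin n)) :=
  {w | ∀ p : Fin n, rowOf lam ((w p : Fin n) : ℕ) = rowOf lam (p : ℕ)}

/-- The adjacent transposition `(i, i+1)` (0-indexed) in `S_n`. -/
def adjT {n : ℕ} (i : ℕ) (h : i + 1 < n) : Equiv.Perm (Fin n) :=
  Equiv.swap ⟨i, Nat.lt_of_succ_lt h⟩ ⟨i+1, h⟩

/-- `T : S_n → H` is the standard basis of an Iwahori–Hecke algebra of `S_n` over `F`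
with parameter `q`.  Permutations act on the right, so the product `w·s` of the paper
is `s * w` in Mathlib's convention; the multiplication rule
`T_w T_s = T_{ws}` (length increasing) resp. `T_w T_s = q T_{ws} + (q-1) T_w`
(length decreasing) determines the algebra structure on the basis. -/
structure IsHeckeBasis {F : Type*} [Field F] {H : Type*} [Ring H] [Algebra F H] {n : ℕ}
    (q : F) (T : Equiv.Perm (Fin n) → H) : Prop where
  li : LinearIndependent F T
  total : Submodule.span F (Set.range T) = ⊤
  one : T 1 = 1
  mul_adj_asc : ∀ (w : Equiv.Perm (Fin n)) (i : ℕ) (h : i + 1 < n),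
    permLength w < permLength (adjT i h * w) →
    T w * T (adjT i h) = T (adjT i h * w)
  mul_adj_desc : ∀ (w : Equiv.Perm (Fin n)) (i : ℕ) (h : i + 1 < n),
    permLength (adjT i h * w) < permLength w →
    T w * T (adjT i h) = q • T (adjT i h * w) + (q - 1) • T w

variable {F : Type*} [Field F] {H : Type*} [Ring H] [Algebra F H] {n : ℕ}

/-- `x_λ = ∑_{w ∈ W_λ} T_w`. -/
def xElt (T : Equiv.Perm (Fin n) → H) (lam : ℕ → ℕ) : H :=
  ∑ w ∈ Finset.univ.filter (· ∈ youngW lam), T w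

/-- `y_λ = ∑_{w ∈ W_λ} (-q)^{-l(w)} T_w`. -/
def yElt (q : F) (T : Equiv.Perm (Fin n) → H) (lam : ℕ → ℕ) : H :=
  ∑ w ∈ Finset.univ.filter (· ∈ youngW lam), ((-q)⁻¹) ^ permLength w • T w

/-- The double coset `W_λ d W_μ` (paper convention: maps act on the right, so the
paper product `u·d·v` is `v * d * u` in Mathlib's convention). -/
def doubleCoset {n : ℕ} (lam mu : ℕ → ℕ) (d : Equiv.Perm (Fin n)) :
    Set (Equiv.Perm (Fin n)) :=
  {w | ∃ u ∈ youngW (n := n) lam, ∃ v ∈ youngW (n := n) mu, w = v * d * u}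

/-- `∑_{w ∈ W_λ 1_A W_μ} T_w`, the image `x_μ φ_A` of `x_μ` under the tableau
homomorphism `φ_A : M^μ → M^λ`, where `d = 1_A`. -/
def XPhi (T : Equiv.Perm (Fin n) → H) (lam mu : ℕ → ℕ) (d : Equiv.Perm (Fin n)) : H :=
  ∑ w ∈ Finset.univ.filter (· ∈ doubleCoset lam mu d), T w

/-- A row-standard tableau is recorded by the multisets of entries of its rows; it has
shape `μ` when row `r` has `μ_r` entries. -/
def RowsOfShape (mu : ℕ → ℕ) (A : ℕ → Multiset ℕ) : Prop := ∀ r, (A r).card = mu r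

/-- The tableau with rows `A 0, A 1, …` has type `λ` when the entry `v` occurs `λ_v`
times in total (entries and types are 0-indexed). -/
def HasType (A : ℕ → Multiset ℕ) (lam : ℕ → ℕ) : Prop :=
  ∀ v, (∑ᶠ r, (A r).count v) = lam v

/-- The entry in row `r`, column `c` (0-indexed) of the row-standard tableau with row
multisets `A`. -/
def entryAt (A : ℕ → Multiset ℕ) (r c : ℕ) : ℕ := ((A r).sort (· ≤ ·)).getD c 0

/-- `d = 1_A` for the row-standard `μ`-tableau `A` of type `λ`: the tableau `t^λ d`
(whose entry at position `p` is `d p`) is row-standard (first clause), and the entry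
`d p` lies in row `r` of `t^λ d` exactly when the position occupied by `d p` in `t^μ`
is occupied by `r` in `A` (second clause). -/
def Is1A {n : ℕ} (mu lam : ℕ → ℕ) (A : ℕ → Multiset ℕ) (d : Equiv.Perm (Fin n)) : Prop :=
  (∀ p p' : Fin n, rowOf lam (p : ℕ) = rowOf lam (p' : ℕ) → p < p' → d p < d p') ∧
  (∀ p : Fin n,
    entryAt A (rowOf mu ((d p : Fin n) : ℕ))
      (((d p : Fin n) : ℕ) - cumSum mu (rowOf mu ((d p : Fin n) : ℕ)))
      = rowOf lam (p : ℕ))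

/-- A row-standard tableau is semistandard if its columns are strictly increasing. -/
def Semistandard (mu : ℕ → ℕ) (A : ℕ → Multiset ℕ) : Prop :=
  ∀ r c, c < mu (r+1) → entryAt A r c < entryAt A (r+1) c

/-- The (0-indexed) column of the position `p` in the diagram of `μ`. -/
def colIdx (mu : ℕ → ℕ) (p : ℕ) : ℕ := p - cumSum mu (rowOf mu p)

/-- `w = w_μ`, i.e. `t^μ w = t_μ`: the image of position `p` is the number of positions
coming strictly before `p` in the column-reading order of the diagram of `μ`. -/
def IsWmu {n : ℕ} (mu : ℕ → ℕ) (w : Equiv.Perm (Fin n)) : Prop :=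
  ∀ p : Fin n, ((w p : Fin n) : ℕ) = (Finset.univ.filter (fun p' : Fin n =>
    colIdx mu (p' : ℕ) < colIdx mu (p : ℕ) ∨
      (colIdx mu (p' : ℕ) = colIdx mu (p : ℕ) ∧ rowOf mu (p' : ℕ) < rowOf mu (p : ℕ)))).card

def comp1 (a : ℕ) : ℕ → ℕ := fun r => if r = 0 then a else 0
def comp2 (a b : ℕ) : ℕ → ℕ := fun r => if r = 0 then a else if r = 1 then b else 0
def comp3 (a b c : ℕ) : ℕ → ℕ :=
  fun r => if r = 0 then a else if r = 1 then b else if r = 2 then c else 0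
def comp4 (a b c d : ℕ) : ℕ → ℕ :=
  fun r => if r = 0 then a else if r = 1 then b else if r = 2 then c else if r = 3 then d else 0
def rows1 (a : Multiset ℕ) : ℕ → Multiset ℕ := fun r => if r = 0 then a else 0
def rows2 (a b : Multiset ℕ) : ℕ → Multiset ℕ :=
  fun r => if r = 0 then a else if r = 1 then b else 0
def rows3 (a b c : Multiset ℕ) : ℕ → Multiset ℕ :=
  fun r => if r = 0 then a else if r = 1 then b else if r = 2 then c else 0
def rows4 (a b c d : Multiset ℕ) : ℕ → Multiset ℕ :=
  fun r => if r = 0 then a else if r = 1 then b else if r = 2 then c else if r = 3 then d else 0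

end FayersSemistd
namespace FayersSemistd

theorem perm_apply_inv_apply {α : Type*} (w : Equiv.Perm α) (x : α) : w (w⁻¹ x) = x :=
  w.apply_symm_apply x

theorem adjT_apply_val {n : ℕ} (i : ℕ) (h : i + 1 < n) (x : Fin n) :
    (adjT i h x : ℕ) = if (x : ℕ) = i then i + 1 else if (x : ℕ) = i + 1 then i else x := by
  simp only [adjT, Equiv.swap_apply_def, Fin.ext_iff]
  split_ifs <;> rfl

theorem adjT_mul_self {n : ℕ} (i : ℕ) (h : i + 1 < n) : adjT i h * adjT i h = 1 :=
  Equiv.swap_mul_self _ _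

/-- Multiplying by an adjacent transposition that creates an inversion raises the length by one. -/
theorem permLength_adjT_mul {n : ℕ} (w : Equiv.Perm (Fin n)) (i : ℕ) (h : i + 1 < n)
    (hw : w⁻¹ ⟨i, Nat.lt_of_succ_lt h⟩ < w⁻¹ ⟨i + 1, h⟩) :
    permLength (adjT i h * w) = permLength w + 1 := by
  obtain ⟨x, hx⟩ : ∃ x, w⁻¹ ⟨i, Nat.lt_of_succ_lt h⟩ = x := ⟨_, rfl⟩
  obtain ⟨y, hy⟩ : ∃ y, w⁻¹ ⟨i + 1, h⟩ = y := ⟨_, rfl⟩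
  rw [hx, hy] at hw
  rw [Equiv.Perm.inv_eq_iff_eq] at hx hy
  have hx' : ∀ a, (w a : ℕ) = i ↔ a = x := fun a => by
    rw [← w.injective.eq_iff, ← hx, Fin.ext_iff]
  have hy' : ∀ a, (w a : ℕ) = i + 1 ↔ a = y := fun a => by
    rw [← w.injective.eq_iff, ← hy, Fin.ext_iff]
  unfold permLength
  rw [← Finset.card_insert_of_notMem (a := (x, y))]
  · congr 1
    ext ⟨a, b⟩
    simp only [Finset.mem_filter, Finset.mem_univ, true_and, Finset.mem_insert, Prod.mk.injEq,
      Equiv.Perm.mul_apply, Fin.lt_def (a := adjT i h _), adjT_apply_val, Fin.lt_def (a := w _)]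
    have ha := hx' a
    have hb := hx' b
    have ha' := hy' a
    have hb' := hy' b
    have hab : (w a : ℕ) = w b ↔ a = b := by rw [← Fin.ext_iff, w.injective.eq_iff]
    rw [Fin.lt_def] at *
    rw [Fin.ext_iff] at *
    split_ifs <;> omega
  · simp only [Finset.mem_filter, Finset.mem_univ, true_and, not_and, not_lt]
    intro _
    rw [← hx, ← hy]
    simp [Fin.le_def]

/-- Every permutation is reached from `1` by length-increasing adjacent transpositions. -/
theorem perm_induction_adjT {n : ℕ} {P : Equiv.Perm (Fin n) → Prop} (one : P 1)
    (step : ∀ (v : Equiv.Perm (Fin n)) (i : ℕ) (h : i + 1 < n),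
      v⁻¹ ⟨i, Nat.lt_of_succ_lt h⟩ < v⁻¹ ⟨i + 1, h⟩ → P v → P (adjT i h * v))
    (v : Equiv.Perm (Fin n)) : P v := by
  induction hl : permLength v using Nat.strong_induction_on generalizing v with
  | _ l ih =>
    by_cases hv : ∀ (i : ℕ) (h : i + 1 < n),
        v⁻¹ ⟨i, Nat.lt_of_succ_lt h⟩ < v⁻¹ ⟨i + 1, h⟩
    · have hmono : StrictMono (v⁻¹ : Equiv.Perm (Fin n)) := by
        cases n with
        | zero => exact fun a => a.elim0
        | succ n =>
          rw [Fin.strictMono_iff_lt_succ]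
          exact fun i => hv i (by omega)
      have hid : (v⁻¹ : Equiv.Perm (Fin n)) = 1 := by
        apply Equiv.coe_fn_injective
        exact (hmono.range_inj strictMono_id).1 (by simp)
      rw [inv_eq_one] at hid
      exact hid ▸ one
    · push Not at hv
      obtain ⟨i, h, hlt⟩ := hv
      have hasc : (adjT i h * v)⁻¹ ⟨i, Nat.lt_of_succ_lt h⟩ < (adjT i h * v)⁻¹ ⟨i + 1, h⟩ := by
        have hne : v⁻¹ ⟨i + 1, h⟩ ≠ v⁻¹ ⟨i, Nat.lt_of_succ_lt h⟩ := by simp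
        simpa [mul_inv_rev, adjT] using lt_of_le_of_ne hlt hne
      have hlen := permLength_adjT_mul _ i h hasc
      have hstep := step _ i h hasc (ih _ ?_ _ rfl)
      · rwa [← mul_assoc, adjT_mul_self, one_mul] at hstep
      · rw [← mul_assoc, adjT_mul_self, one_mul] at hlen
        omega

/-- No inversion of `u` is undone by `v`. -/
def InversionsPersist {n : ℕ} (u v : Equiv.Perm (Fin n)) : Prop :=
  ∀ a b, a < b → u b < u a → v (u b) < v (u a)

theorem InversionsPersist.of_adjT_mul {n : ℕ} {u v : Equiv.Perm (Fin n)} {i : ℕ} {h : i + 1 < n}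
    (hv : v⁻¹ ⟨i, Nat.lt_of_succ_lt h⟩ < v⁻¹ ⟨i + 1, h⟩)
    (H : InversionsPersist u (adjT i h * v)) :
    InversionsPersist u v ∧ (v * u)⁻¹ ⟨i, Nat.lt_of_succ_lt h⟩ < (v * u)⁻¹ ⟨i + 1, h⟩ := by
  constructor
  · intro a b hab hu
    have h1 := H a b hab hu
    by_contra hcon
    have hne : (v (u b) : ℕ) ≠ v (u a) := by
      rw [Ne, ← Fin.ext_iff, v.injective.eq_iff, u.injective.eq_iff]
      exact hab.ne'
    simp only [Equiv.Perm.mul_apply, Fin.lt_def, adjT_apply_val] at h1 hcon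
    have hboth : (v (u a) : ℕ) = i ∧ (v (u b) : ℕ) = i + 1 := by
      split_ifs at h1 <;> omega
    have e1 : v (u a) = ⟨i, Nat.lt_of_succ_lt h⟩ := Fin.ext hboth.1
    have e2 : v (u b) = ⟨i + 1, h⟩ := Fin.ext hboth.2
    rw [← e1, ← e2] at hv
    simp only [Equiv.Perm.coe_inv, Equiv.symm_apply_apply] at hv
    exact lt_asymm hu hv
  · by_contra hcon
    have hne : (v * u)⁻¹ ⟨i + 1, h⟩ ≠ (v * u)⁻¹ ⟨i, Nat.lt_of_succ_lt h⟩ := by simp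
    have h1 := H _ _ (lt_of_le_of_ne (not_lt.1 hcon) hne)
    simp only [mul_inv_rev, Equiv.Perm.mul_apply, perm_apply_inv_apply] at h1
    have h2 := h1 hv
    simp [adjT, Fin.lt_def] at h2

theorem permLength_one {n : ℕ} : permLength (1 : Equiv.Perm (Fin n)) = 0 := by
  simp only [permLength, Finset.card_eq_zero, Finset.filter_eq_empty_iff]
  rintro p - ⟨h1, h2⟩
  exact lt_asymm h1 h2

theorem InversionsPersist.permLength_mul {n : ℕ} {u v : Equiv.Perm (Fin n)}
    (H : InversionsPersist u v) : permLength (v * u) = permLength v + permLength u := by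
  induction v using perm_induction_adjT with
  | one => simp [permLength_one]
  | step v i h hv ih =>
    obtain ⟨h1, h2⟩ := H.of_adjT_mul hv
    rw [mul_assoc, permLength_adjT_mul _ i h h2, permLength_adjT_mul _ i h hv, ih h1]
    omega

section Hecke

variable {F : Type*} [Field F] {H : Type*} [Ring H] [Algebra F H] {n : ℕ} {q : F}
  {T : Equiv.Perm (Fin n) → H}

theorem IsHeckeBasis.mul_adjT (hT : IsHeckeBasis q T) (v : Equiv.Perm (Fin n)) (i : ℕ)
    (h : i + 1 < n) (hv : v⁻¹ ⟨i, Nat.lt_of_succ_lt h⟩ < v⁻¹ ⟨i + 1, h⟩) :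
    T v * T (adjT i h) = T (adjT i h * v) :=
  hT.mul_adj_asc v i h (by rw [permLength_adjT_mul v i h hv]; omega)

theorem IsHeckeBasis.mul_of_inversionsPersist (hT : IsHeckeBasis q T)
    {u v : Equiv.Perm (Fin n)} (huv : InversionsPersist u v) : T u * T v = T (v * u) := by
  induction v using perm_induction_adjT with
  | one => simp [hT.one]
  | step v i h hv ih =>
    obtain ⟨h1, h2⟩ := huv.of_adjT_mul hv
    rw [← hT.mul_adjT v i h hv, ← mul_assoc, ih h1, hT.mul_adjT _ i h h2, mul_assoc]

end Hecke

/-- Right-shift by `m`, as an embedding of `{0,…,n-m-1}` into `{0,…,n-1}`. -/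
def shiftEmb (n m : ℕ) : Fin (n - m) ↪ Fin n where
  toFun i := ⟨i + m, by omega⟩
  inj' a b hab := by
    simp only [Fin.mk.injEq] at hab
    omega

theorem shiftEmb_val {n m : ℕ} (i : Fin (n - m)) : (shiftEmb n m i : ℕ) = i + m := rfl

theorem shiftEmb_cases {n m : ℕ} (x : Fin n) :
    ((x : ℕ) < m ∧ x ∉ Set.range (shiftEmb n m)) ∨ ∃ i, x = shiftEmb n m i := by
  by_cases hx : (x : ℕ) < m
  · refine Or.inl ⟨hx, ?_⟩
    rintro ⟨i, rfl⟩
    rw [shiftEmb_val] at hx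
    omega
  · exact Or.inr ⟨⟨x - m, by omega⟩, Fin.ext (by rw [shiftEmb_val]; simp only; omega)⟩

/-- The embedding `S_{n-m} → S_n` acting on the last `n - m` points. -/
def shiftPerm (n m : ℕ) : Equiv.Perm (Fin (n - m)) →* Equiv.Perm (Fin n) :=
  Equiv.Perm.viaEmbeddingHom (shiftEmb n m)

theorem shiftPerm_apply {n m : ℕ} (v : Equiv.Perm (Fin (n - m))) (i : Fin (n - m)) :
    shiftPerm n m v (shiftEmb n m i) = shiftEmb n m (v i) :=
  Equiv.Perm.viaEmbedding_apply _ _ _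

theorem shiftPerm_apply_of_lt {n m : ℕ} (v : Equiv.Perm (Fin (n - m))) (x : Fin n)
    (hx : (x : ℕ) < m) : shiftPerm n m v x = x := by
  refine Equiv.Perm.viaEmbedding_apply_of_notMem _ _ _ ?_
  rintro ⟨i, rfl⟩
  rw [shiftEmb_val] at hx
  omega

theorem shiftPerm_adjT {n m : ℕ} (i : ℕ) (h : i + 1 < n - m) :
    shiftPerm n m (adjT i h) = adjT (i + m) (by omega) := by
  ext x
  rcases shiftEmb_cases (m := m) x with ⟨hx, -⟩ | ⟨j, rfl⟩
  · rw [shiftPerm_apply_of_lt _ _ hx, adjT_apply_val]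
    split_ifs <;> omega
  · rw [shiftPerm_apply, shiftEmb_val, adjT_apply_val, adjT_apply_val, shiftEmb_val]
    split_ifs <;> omega

theorem shiftPerm_ascent {n m : ℕ} (v : Equiv.Perm (Fin (n - m))) (i : ℕ) (h : i + 1 < n - m)
    (hv : v⁻¹ ⟨i, Nat.lt_of_succ_lt h⟩ < v⁻¹ ⟨i + 1, h⟩) :
    (shiftPerm n m v)⁻¹ ⟨i + m, by omega⟩ < (shiftPerm n m v)⁻¹ ⟨i + m + 1, by omega⟩ := by
  have e1 : (⟨i + m, by omega⟩ : Fin n) = shiftEmb n m ⟨i, by omega⟩ := rfl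
  have e2 : (⟨i + m + 1, by omega⟩ : Fin n) = shiftEmb n m ⟨i + 1, h⟩ :=
    Fin.ext (by rw [shiftEmb_val]; simp only; omega)
  rw [e1, e2, ← map_inv, shiftPerm_apply, shiftPerm_apply, Fin.lt_def, shiftEmb_val, shiftEmb_val]
  rw [Fin.lt_def] at hv
  omega

theorem permLength_shiftPerm {n m : ℕ} (v : Equiv.Perm (Fin (n - m))) :
    permLength (shiftPerm n m v) = permLength v := by
  induction v using perm_induction_adjT with
  | one => simp [permLength_one]
  | step v i h hv ih =>
    rw [map_mul, shiftPerm_adjT, permLength_adjT_mul _ _ _ (shiftPerm_ascent v i h hv), ih,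
      permLength_adjT_mul _ _ _ hv]

theorem map_heckeBasis_eq_shiftPerm {F : Type*} [Field F] {H : Type*} [Ring H] [Algebra F H]
    {H' : Type*} [Ring H'] [Algebra F H'] {n m : ℕ} {q : F}
    {T : Equiv.Perm (Fin n) → H} (hT : IsHeckeBasis q T)
    {T' : Equiv.Perm (Fin (n - m)) → H'} (hT' : IsHeckeBasis q T')
    (g : H' →ₐ[F] H)
    (hg : ∀ (i : ℕ) (hi : i + 1 < n - m), g (T' (adjT i hi)) = T (adjT (i + m) (by omega)))
    (v : Equiv.Perm (Fin (n - m))) : g (T' v) = T (shiftPerm n m v) := by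
  induction v using perm_induction_adjT with
  | one => simp [hT.one, hT'.one]
  | step v i h hv ih =>
    rw [← hT'.mul_adjT v i h hv, map_mul, ih, hg, map_mul, shiftPerm_adjT,
      hT.mul_adjT _ _ _ (shiftPerm_ascent v i h hv)]

/-- Each left coset `x K` contains an element increasing on all pairs whose transposition
lies in `K`. -/
theorem exists_mul_mem_increasing {n : ℕ} (K : Subgroup (Equiv.Perm (Fin n)))
    (x : Equiv.Perm (Fin n)) :
    ∃ k ∈ K, ∀ a b, a < b → Equiv.swap a b ∈ K → (x * k) a < (x * k) b := by
  obtain ⟨k, hk, hmax⟩ := Finset.exists_max_image (Finset.univ.filter (· ∈ K))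
    (fun k => ∑ c : Fin n, ((c : ℕ) : ℤ) * (((x * k) c : ℕ) : ℤ)) ⟨1, by simp [K.one_mem]⟩
  simp only [Finset.mem_filter, Finset.mem_univ, true_and] at hk hmax
  refine ⟨k, hk, fun a b hab hswap => ?_⟩
  by_contra hcon
  have hne : (x * k) b ≠ (x * k) a := by simpa using hab.ne'
  have hlt := lt_of_le_of_ne (not_lt.1 hcon) hne
  have hle := hmax _ (K.mul_mem hk hswap)
  rw [← Equiv.sum_comp (Equiv.swap a b), ← sub_nonneg, ← Finset.sum_sub_distrib,
    Fintype.sum_eq_add a b hab.ne] at hle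
  · simp only [Equiv.Perm.mul_apply, Equiv.swap_apply_left, Equiv.swap_apply_right, Fin.lt_def]
      at hle hlt hab
    zify at hlt hab
    nlinarith
  · rintro c ⟨hca, hcb⟩
    simp [Equiv.swap_apply_of_ne_of_ne hca hcb]

/-- The subgroup of permutations preserving the levels of `b`. -/
def levelSubgroup {n : ℕ} (b : Fin n → ℕ) : Subgroup (Equiv.Perm (Fin n)) where
  carrier := {w | ∀ p, b (w p) = b p}
  one_mem' _ := rfl
  mul_mem' hv hw p := by
    rw [Equiv.Perm.mul_apply, hv, hw]
  inv_mem' {w} hw p := by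
    have := hw (w⁻¹ p)
    rw [perm_apply_inv_apply] at this
    exact this.symm

theorem mem_levelSubgroup {n : ℕ} {b : Fin n → ℕ} {w : Equiv.Perm (Fin n)} :
    w ∈ levelSubgroup b ↔ ∀ p, b (w p) = b p := Iff.rfl

/-- `d` is increasing on the first `m` points and on the remaining ones, and carries the first
`m` points to the least elements of levels of the monotone function `b`. -/
structure RemovesFirsts {n : ℕ} (m : ℕ) (d : Equiv.Perm (Fin n)) (b : Fin n → ℕ)
    (bt : Fin (n - m) → ℕ) : Prop where
  strictMono_shift : ∀ i j, i < j → d (shiftEmb n m i) < d (shiftEmb n m j)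
  strictMono_first : ∀ x y : Fin n, (y : ℕ) < m → x < y → d x < d y
  monotone : Monotone b
  first : ∀ x y : Fin n, (x : ℕ) < m → y < d x → b y < b (d x)
  level : ∀ i, b (d (shiftEmb n m i)) = bt i

namespace RemovesFirsts

variable {n m : ℕ} {d : Equiv.Perm (Fin n)} {b : Fin n → ℕ} {bt : Fin (n - m) → ℕ}

theorem inversionsPersist_shiftPerm (h : RemovesFirsts m d b bt) (v : Equiv.Perm (Fin (n - m))) :
    InversionsPersist (shiftPerm n m v) d := by
  intro x y hxy hlt
  rcases shiftEmb_cases (m := m) x with ⟨hx, -⟩ | ⟨i, rfl⟩ <;>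
    rcases shiftEmb_cases (m := m) y with ⟨hy, -⟩ | ⟨j, rfl⟩
  · rw [shiftPerm_apply_of_lt _ _ hx, shiftPerm_apply_of_lt _ _ hy] at hlt
    exact absurd hlt hxy.asymm
  · rw [shiftPerm_apply_of_lt _ _ hx, shiftPerm_apply, Fin.lt_def, shiftEmb_val] at hlt
    omega
  · rw [Fin.lt_def, shiftEmb_val] at hxy
    omega
  · rw [shiftPerm_apply, shiftPerm_apply] at hlt ⊢
    apply h.strictMono_shift
    rw [Fin.lt_def, shiftEmb_val, shiftEmb_val] at hlt
    rw [Fin.lt_def]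
    omega

/-- The conjugate by `d` of the shift of `v`. -/
def conjShift (n m : ℕ) (d : Equiv.Perm (Fin n)) :
    Equiv.Perm (Fin (n - m)) →* Equiv.Perm (Fin n) :=
  (MulAut.conj d).toMonoidHom.comp (shiftPerm n m)

theorem conjShift_mul (v : Equiv.Perm (Fin (n - m))) :
    conjShift n m d v * d = d * shiftPerm n m v := by
  simp [conjShift]

theorem conjShift_apply (v : Equiv.Perm (Fin (n - m))) (x : Fin n) :
    conjShift n m d v (d x) = d (shiftPerm n m v x) := by
  simp [conjShift]

theorem conjShift_injective : Function.Injective (conjShift n m d) :=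
  (MulAut.conj d).injective.comp (Equiv.Perm.viaEmbeddingHom_injective _)

theorem conjShift_mem (h : RemovesFirsts m d b bt) {v : Equiv.Perm (Fin (n - m))}
    (hv : v ∈ levelSubgroup bt) : conjShift n m d v ∈ levelSubgroup b := by
  intro p
  obtain ⟨x, rfl⟩ := d.surjective p
  rw [conjShift_apply]
  rcases shiftEmb_cases (m := m) x with ⟨hx, -⟩ | ⟨i, rfl⟩
  · rw [shiftPerm_apply_of_lt _ _ hx]
  · rw [shiftPerm_apply, h.level, h.level, hv]

theorem inversionsPersist_conjShift (h : RemovesFirsts m d b bt)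
    {v : Equiv.Perm (Fin (n - m))} (hv : v ∈ levelSubgroup bt) :
    InversionsPersist d (conjShift n m d v) := by
  intro x y hxy hlt
  rw [conjShift_apply, conjShift_apply]
  rcases shiftEmb_cases (m := m) y with ⟨hy, -⟩ | ⟨j, rfl⟩
  · exact absurd hlt (h.strictMono_first x y hy hxy).asymm
  rcases shiftEmb_cases (m := m) x with ⟨hx, -⟩ | ⟨i, rfl⟩
  · have h1 := h.first x _ hx hlt
    rw [shiftPerm_apply_of_lt _ _ hx, shiftPerm_apply]
    rw [h.level, ← hv j, ← h.level] at h1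
    exact h.monotone.reflect_lt h1
  · refine absurd hlt (h.strictMono_shift i j ?_).asymm
    rw [Fin.lt_def, shiftEmb_val, shiftEmb_val] at hxy
    rw [Fin.lt_def]
    omega

theorem permLength_conjShift (h : RemovesFirsts m d b bt)
    {v : Equiv.Perm (Fin (n - m))} (hv : v ∈ levelSubgroup bt) :
    permLength (conjShift n m d v) = permLength v := by
  have h1 := (h.inversionsPersist_conjShift hv).permLength_mul
  have h2 := (h.inversionsPersist_shiftPerm v).permLength_mul
  rw [conjShift_mul, h2, permLength_shiftPerm] at h1
  omega

theorem swap_mem_map_conjShift (i j : Fin (n - m))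
    (hij : bt i = bt j) :
    Equiv.swap (d (shiftEmb n m i)) (d (shiftEmb n m j)) ∈
      (levelSubgroup bt).map (conjShift n m d) := by
  refine ⟨Equiv.swap i j, ?_, ?_⟩
  · intro p
    rw [Equiv.swap_apply_def]
    split_ifs with h1 h2
    · rw [h1, hij]
    · rw [h2, hij]
    · rfl
  · ext p
    obtain ⟨x, rfl⟩ := d.surjective p
    rw [conjShift_apply]
    rcases shiftEmb_cases (m := m) x with ⟨hx, hx'⟩ | ⟨k, rfl⟩
    · rw [shiftPerm_apply_of_lt _ _ hx, Equiv.swap_apply_of_ne_of_ne]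
      · rintro heq
        exact hx' ⟨i, (d.injective heq).symm⟩
      · rintro heq
        exact hx' ⟨j, (d.injective heq).symm⟩
    · rw [shiftPerm_apply]
      exact congrArg Fin.val ((d.injective.comp (shiftEmb n m).injective).map_swap i j k)

theorem inversionsPersist_of_increasing (h : RemovesFirsts m d b bt)
    {r : Equiv.Perm (Fin n)}
    (hr : ∀ x y, x < y → Equiv.swap x y ∈ (levelSubgroup bt).map (conjShift n m d) → r x < r y)
    {v : Equiv.Perm (Fin (n - m))} (hv : v ∈ levelSubgroup bt) :
    InversionsPersist (conjShift n m d v) r := by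
  intro p p' hlt hinv
  have hmem := h.conjShift_mem hv
  have hb : b p = b p' := by
    refine le_antisymm (h.monotone hlt.le) ?_
    rw [← hmem p, ← hmem p']
    exact h.monotone hinv.le
  obtain ⟨x, rfl⟩ := d.surjective p
  obtain ⟨y, rfl⟩ := d.surjective p'
  rcases shiftEmb_cases (m := m) y with ⟨hy, -⟩ | ⟨j, rfl⟩
  · exact absurd hb (h.first y _ hy hlt).ne
  rcases shiftEmb_cases (m := m) x with ⟨hx, -⟩ | ⟨i, rfl⟩
  · rw [conjShift_apply v x, shiftPerm_apply_of_lt _ _ hx] at hinv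
    have := h.first x _ hx hinv
    rw [hmem] at this
    exact absurd hb this.ne'
  · rw [h.level, h.level] at hb
    apply hr _ _ hinv
    rw [conjShift_apply, conjShift_apply, shiftPerm_apply, shiftPerm_apply]
    apply swap_mem_map_conjShift
    rw [hv, hv, hb]

variable {F : Type*} [Field F] {H : Type*} [Ring H] [Algebra F H] {q : F}
  {T : Equiv.Perm (Fin n) → H}

/-- The signed sum over the level subgroup of `b` is right divisible by the sum over the
subgroup that fixes the points `d x`, `x < m`. -/
theorem dvd_sum_levelSubgroup (h : RemovesFirsts m d b bt) (hT : IsHeckeBasis q T) (c : F) :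
    (∑ v ∈ Finset.univ.filter (· ∈ levelSubgroup bt),
      c ^ permLength v • T (conjShift n m d v)) ∣
    ∑ w ∈ Finset.univ.filter (· ∈ levelSubgroup b), c ^ permLength w • T w := by
  set K := (levelSubgroup bt).map (conjShift n m d)
  have hKb : K ≤ levelSubgroup b := by
    rintro _ ⟨v, hv, rfl⟩
    exact h.conjShift_mem hv
  rw [← Finset.sum_fiberwise (Finset.univ.filter (· ∈ levelSubgroup b))
    (fun w => (QuotientGroup.mk w : Equiv.Perm (Fin n) ⧸ K))]
  refine Finset.dvd_sum fun Q _ => ?_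
  obtain ⟨x, rfl⟩ := QuotientGroup.mk_surjective Q
  by_cases hx : x ∈ levelSubgroup b
  · obtain ⟨k, hk, hr⟩ := exists_mul_mem_increasing K x
    have hrb : x * k ∈ levelSubgroup b := mul_mem hx (hKb hk)
    have hxr : (QuotientGroup.mk x : Equiv.Perm (Fin n) ⧸ K) = QuotientGroup.mk (x * k) :=
      (QuotientGroup.mk_mul_of_mem x hk).symm
    rw [hxr]
    generalize x * k = r at hr hrb
    refine ⟨c ^ permLength r • T r, ?_⟩
    rw [Finset.sum_mul]
    symm
    refine Finset.sum_bij (fun v _ => r * conjShift n m d v) ?_ ?_ ?_ ?_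
    · intro v hv
      simp only [Finset.mem_filter, Finset.mem_univ, true_and] at hv ⊢
      exact ⟨mul_mem hrb (h.conjShift_mem hv),
        QuotientGroup.mk_mul_of_mem r (Subgroup.mem_map_of_mem _ hv)⟩
    · intro v _ v' _ hvv
      exact conjShift_injective (mul_left_cancel hvv)
    · intro w hw
      simp only [Finset.mem_filter, Finset.mem_univ, true_and] at hw
      obtain ⟨v, hv, hvw⟩ := QuotientGroup.eq.1 hw.2.symm
      refine ⟨v, by simpa using hv, ?_⟩
      rw [hvw, mul_inv_cancel_left]
    · intro v hv
      simp only [Finset.mem_filter, Finset.mem_univ, true_and] at hv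
      have hp := h.inversionsPersist_of_increasing hr hv
      rw [smul_mul_smul_comm, hT.mul_of_inversionsPersist hp, hp.permLength_mul,
        h.permLength_conjShift hv, ← pow_add, add_comm]
  · rw [Finset.sum_eq_zero (s := Finset.filter _ (Finset.filter _ _))]
    · exact dvd_zero _
    · intro w hw
      simp only [Finset.mem_filter, Finset.mem_univ, true_and] at hw
      refine absurd ?_ hx
      have hmem := hKb (QuotientGroup.eq.1 hw.2)
      simpa using mul_mem hw.1 hmem

end RemovesFirsts

section Tableau

theorem cumSum_succ (lam : ℕ → ℕ) (r : ℕ) : cumSum lam (r + 1) = cumSum lam r + lam r :=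
  Finset.sum_range_succ _ _

theorem cumSum_mono (lam : ℕ → ℕ) : Monotone (cumSum lam) :=
  monotone_nat_of_le_succ fun r => by rw [cumSum_succ]; omega

theorem cumSum_tail (lam : ℕ → ℕ) (r : ℕ) :
    cumSum lam (r + 1) = cumSum (fun s => lam (s + 1)) r + lam 0 :=
  Finset.sum_range_succ' _ _

theorem rowOf_eq {lam : ℕ → ℕ} {p r : ℕ} (h1 : cumSum lam r ≤ p) (h2 : p < cumSum lam (r + 1)) :
    rowOf lam p = r := by
  refine le_antisymm (Nat.sInf_le h2) ?_
  refine le_csInf ⟨r, h2⟩ fun s hs => ?_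
  by_contra hcon
  have := cumSum_mono lam (show s + 1 ≤ r by omega)
  simp only [Set.mem_ofPred_eq] at hs
  omega

theorem IsComposition.rowOf_spec {n : ℕ} {lam : ℕ → ℕ} (hlam : IsComposition n lam) {p : ℕ}
    (hp : p < n) : cumSum lam (rowOf lam p) ≤ p ∧ p < cumSum lam (rowOf lam p + 1) := by
  obtain ⟨N, hN, hsum⟩ := hlam
  have hne : {r | p < cumSum lam (r + 1)}.Nonempty :=
    ⟨N, by simp only [Set.mem_ofPred_eq, cumSum_succ]; omega⟩
  refine ⟨?_, Nat.sInf_mem hne⟩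
  rcases hr : rowOf lam p with _ | r
  · simp [cumSum]
  · by_contra hcon
    have := Nat.sInf_le (s := {r | p < cumSum lam (r + 1)}) (m := r) (by simpa using hcon)
    change rowOf lam p ≤ r at this
    omega

theorem IsComposition.cumSum_le {n : ℕ} {lam : ℕ → ℕ} (hlam : IsComposition n lam) (r : ℕ) :
    cumSum lam r ≤ n := by
  obtain ⟨N, hN, hsum⟩ := hlam
  rcases le_total r N with h | h
  · exact hsum ▸ cumSum_mono lam h
  · rw [← hsum]
    refine le_of_eq ?_
    symm
    apply Finset.sum_subset (by simpa using h)
    intro s _ hs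
    exact hN s (by simpa using hs)

theorem colIdx_eq {lam : ℕ → ℕ} {p r : ℕ} (h1 : cumSum lam r ≤ p)
    (h2 : p < cumSum lam (r + 1)) : colIdx lam p = p - cumSum lam r := by
  rw [colIdx, rowOf_eq h1 h2]

theorem IsPartition.tail {n : ℕ} {mu : ℕ → ℕ} (hmu : IsPartition n mu) :
    IsPartition (n - mu 0) (fun s => mu (s + 1)) := by
  obtain ⟨⟨N, hN, hsum⟩, hanti⟩ := hmu
  refine ⟨⟨N, fun r hr => hN _ (by omega), ?_⟩, fun a b hab => hanti (by omega)⟩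
  have h1 := cumSum_tail mu N
  rw [cumSum_succ, hN N le_rfl] at h1
  omega

theorem IsPartition.lt_conjP_iff {n : ℕ} {mu : ℕ → ℕ} (hmu : IsPartition n mu) {r c : ℕ} :
    r < conjP mu c ↔ c < mu r := by
  obtain ⟨⟨N, hN, -⟩, hanti⟩ := hmu
  have hmem : mu (conjP mu c) ≤ c :=
    Nat.sInf_mem (s := {r | mu r ≤ c}) ⟨N, by simp [hN N le_rfl]⟩
  constructor
  · intro h
    by_contra hcon
    exact absurd (Nat.sInf_le (s := {r | mu r ≤ c}) (not_lt.1 hcon)) (not_le.2 h)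
  · intro h
    by_contra hcon
    exact absurd (hanti (not_lt.1 hcon)) (by omega)

theorem IsPartition.card_colIdx_eq {n : ℕ} {mu : ℕ → ℕ} (hmu : IsPartition n mu) (c : ℕ) :
    (Finset.univ.filter fun p : Fin n => colIdx mu p = c).card = conjP mu c := by
  rw [← Finset.card_range (conjP mu c)]
  refine Finset.card_bij (fun p _ => rowOf mu p) ?_ ?_ ?_
  · intro p hp
    simp only [Finset.mem_filter, Finset.mem_univ, true_and] at hp
    rw [colIdx] at hp
    have := hmu.1.rowOf_spec p.2
    rw [cumSum_succ] at this
    rw [Finset.mem_range, hmu.lt_conjP_iff]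
    omega
  · intro p hp p' hp' heq
    simp only [Finset.mem_filter, Finset.mem_univ, true_and] at hp hp'
    rw [colIdx] at hp hp'
    have h1 := hmu.1.rowOf_spec p.2
    have h2 := hmu.1.rowOf_spec p'.2
    rw [heq] at h1 hp
    exact Fin.ext (by omega)
  · intro r hr
    rw [Finset.mem_range, hmu.lt_conjP_iff] at hr
    have h1 := hmu.1.cumSum_le (r + 1)
    have h2 := cumSum_succ mu r
    have h3 : cumSum mu r ≤ cumSum mu r + c := by omega
    have h4 : cumSum mu r + c < cumSum mu (r + 1) := by omega
    refine ⟨⟨cumSum mu r + c, by omega⟩, ?_, rowOf_eq h3 h4⟩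
    simp [colIdx_eq h3 h4]

theorem IsPartition.cumSum_conjP {n : ℕ} {mu : ℕ → ℕ} (hmu : IsPartition n mu) (c : ℕ) :
    cumSum (conjP mu) c = (Finset.univ.filter fun p : Fin n => colIdx mu p < c).card := by
  induction c with
  | zero => simp [cumSum]
  | succ c ih =>
    rw [cumSum_succ, ih, ← hmu.card_colIdx_eq c, ← Finset.card_union_of_disjoint]
    · congr 1
      ext p
      simp only [Finset.mem_union, Finset.mem_filter, Finset.mem_univ, true_and]
      omega
    · rw [Finset.disjoint_filter]
      intro p _ h
      omega

/-- `p'` comes strictly before `p` when the diagram of `μ` is read down columns. -/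
def ColBefore (mu : ℕ → ℕ) (p' p : ℕ) : Prop :=
  colIdx mu p' < colIdx mu p ∨ (colIdx mu p' = colIdx mu p ∧ rowOf mu p' < rowOf mu p)

theorem IsWmu.apply_val {n : ℕ} {mu : ℕ → ℕ} {w : Equiv.Perm (Fin n)} (hw : IsWmu mu w)
    (p : Fin n) : (w p : ℕ) = (Finset.univ.filter fun p' : Fin n => ColBefore mu p' p).card := by
  rw [hw p]
  congr

theorem IsWmu.lt_iff {n : ℕ} {mu : ℕ → ℕ} {w : Equiv.Perm (Fin n)} (hw : IsWmu mu w)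
    (p p' : Fin n) : w p < w p' ↔ ColBefore mu p p' := by
  have key : ∀ p p' : Fin n, ColBefore mu p p' → w p < w p' := by
    intro p p' h
    rw [Fin.lt_def, hw.apply_val, hw.apply_val]
    apply Finset.card_lt_card
    rw [Finset.ssubset_iff_of_subset]
    · refine ⟨p, by simpa using h, ?_⟩
      simp only [Finset.mem_filter, Finset.mem_univ, true_and]
      simp [ColBefore]
    · intro x
      simp only [Finset.mem_filter, Finset.mem_univ, true_and]
      unfold ColBefore at *
      omega
  refine ⟨fun h => ?_, key p p'⟩
  by_contra hcon
  by_cases h' : ColBefore mu p' p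
  · exact lt_asymm h (key _ _ h')
  · have heq : colIdx mu p = colIdx mu p' ∧ rowOf mu p = rowOf mu p' := by
      unfold ColBefore at *
      omega
    refine h.ne (Fin.ext ?_)
    rw [hw.apply_val, hw.apply_val]
    congr 1
    ext x
    simp only [Finset.mem_filter, Finset.mem_univ, true_and]
    simp only [ColBefore, heq.1, heq.2]

theorem IsWmu.rowOf_conjP {n : ℕ} {mu : ℕ → ℕ} (hmu : IsPartition n mu)
    {w : Equiv.Perm (Fin n)} (hw : IsWmu mu w) (p : Fin n) :
    rowOf (conjP mu) (w p) = colIdx mu p := by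
  apply rowOf_eq
  · rw [hmu.cumSum_conjP, hw.apply_val]
    apply Finset.card_le_card
    intro x
    simp only [Finset.mem_filter, Finset.mem_univ, true_and]
    unfold ColBefore
    omega
  · rw [hmu.cumSum_conjP, hw.apply_val]
    apply Finset.card_lt_card
    rw [Finset.ssubset_iff_of_subset]
    · refine ⟨p, by simp, ?_⟩
      simp only [Finset.mem_filter, Finset.mem_univ, true_and]
      simp [ColBefore]
    · intro x
      simp only [Finset.mem_filter, Finset.mem_univ, true_and]
      unfold ColBefore
      omega

theorem IsPartition.rowOf_add {n : ℕ} {mu : ℕ → ℕ} (hmu : IsPartition n mu) {p : ℕ}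
    (hp : p < n - mu 0) : rowOf mu (p + mu 0) = rowOf (fun s => mu (s + 1)) p + 1 := by
  have := hmu.tail.1.rowOf_spec hp
  apply rowOf_eq <;> rw [cumSum_tail] <;> omega

theorem IsPartition.colIdx_add {n : ℕ} {mu : ℕ → ℕ} (hmu : IsPartition n mu) {p : ℕ}
    (hp : p < n - mu 0) : colIdx mu (p + mu 0) = colIdx (fun s => mu (s + 1)) p := by
  rw [colIdx, hmu.rowOf_add hp, cumSum_tail, colIdx]
  omega

theorem rowOf_first {mu : ℕ → ℕ} {p : ℕ} (hp : p < mu 0) : rowOf mu p = 0 :=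
  rowOf_eq (by simp [cumSum]) (by simpa [cumSum] using hp)

theorem colIdx_first {mu : ℕ → ℕ} {p : ℕ} (hp : p < mu 0) : colIdx mu p = p := by
  simp [colIdx, rowOf_first hp, cumSum]

theorem IsWmu.removesFirsts {n : ℕ} {mu : ℕ → ℕ} (hmu : IsPartition n mu)
    {w : Equiv.Perm (Fin n)} (hw : IsWmu mu w) {wt : Equiv.Perm (Fin (n - mu 0))}
    (hwt : IsWmu (fun s => mu (s + 1)) wt) :
    RemovesFirsts (mu 0) (w * (shiftPerm n (mu 0) wt)⁻¹)
      (fun p => rowOf (conjP mu) p) (fun p => rowOf (conjP fun s => mu (s + 1)) p) := by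
  have hshift : ∀ i, (w * (shiftPerm n (mu 0) wt)⁻¹) (shiftEmb n (mu 0) i) =
      w (shiftEmb n (mu 0) (wt⁻¹ i)) := fun i => by
    rw [← map_inv, Equiv.Perm.mul_apply, shiftPerm_apply]
  have hfirst : ∀ x : Fin n, (x : ℕ) < mu 0 → (w * (shiftPerm n (mu 0) wt)⁻¹) x = w x :=
    fun x hx => by rw [← map_inv, Equiv.Perm.mul_apply, shiftPerm_apply_of_lt _ _ hx]
  refine ⟨fun i j hij => ?_, fun x y hy hxy => ?_, fun x y hxy => ?_, fun x y hx hy => ?_,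
    fun i => ?_⟩
  · rw [hshift, hshift, hw.lt_iff]
    have h1 : wt (wt⁻¹ i) < wt (wt⁻¹ j) := by simpa using hij
    rw [hwt.lt_iff] at h1
    unfold ColBefore at *
    rw [shiftEmb_val, shiftEmb_val, hmu.colIdx_add (Fin.isLt _), hmu.colIdx_add (Fin.isLt _),
      hmu.rowOf_add (Fin.isLt _), hmu.rowOf_add (Fin.isLt _)]
    omega
  · have hx : (x : ℕ) < mu 0 := lt_trans hxy hy
    rw [hfirst x hx, hfirst y hy, hw.lt_iff, ColBefore, colIdx_first hx, colIdx_first hy]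
    exact Or.inl hxy
  · obtain ⟨x, rfl⟩ := w.surjective x
    obtain ⟨y, rfl⟩ := w.surjective y
    simp only [hw.rowOf_conjP hmu]
    rcases hxy.eq_or_lt with h | h
    · rw [w.injective h]
    · rw [hw.lt_iff, ColBefore] at h
      omega
  · rw [hfirst x hx] at hy ⊢
    obtain ⟨y, rfl⟩ := w.surjective y
    simp only [hw.rowOf_conjP hmu]
    rw [hw.lt_iff, ColBefore, rowOf_first hx] at hy
    omega
  · simp only [hshift, hw.rowOf_conjP hmu]
    rw [shiftEmb_val, hmu.colIdx_add (Fin.isLt _), ← hwt.rowOf_conjP hmu.tail,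
      perm_apply_inv_apply]

end Tableau

theorem yElt_eq_sum_levelSubgroup {F : Type*} [Field F] {H : Type*} [Ring H] [Algebra F H]
    {n : ℕ} (q : F) (T : Equiv.Perm (Fin n) → H) (lam : ℕ → ℕ) :
    yElt q T lam = ∑ w ∈ Finset.univ.filter (· ∈ levelSubgroup fun p : Fin n => rowOf lam p),
      ((-q)⁻¹) ^ permLength w • T w := rfl

/-- Proposition: `T_{w_μ} y_{μ'} ∈ Γ_{μ_1}(T_{w_{μ̃}} y_{μ̃'}) H_n`.
`μ ⊢ n`, `μ̃ = (μ_2, μ_3, …) ⊢ n - μ_1`; `Γ_{μ_1} : H_{n-μ_1} → H_n` the algebra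
map `T_i ↦ T_{i+μ_1}` (called `g` below). -/
theorem twy_top_row_removal
    {F : Type*} [Field F] {H : Type*} [Ring H] [Algebra F H]
    {H' : Type*} [Ring H'] [Algebra F H']
    {n : ℕ} (q : F) (hq : q ≠ 0)
    (mu : ℕ → ℕ) (hmu : IsPartition n mu)
    (T : Equiv.Perm (Fin n) → H) (hT : IsHeckeBasis q T)
    (T' : Equiv.Perm (Fin (n - mu 0)) → H') (hT' : IsHeckeBasis q T')
    (g : H' →ₐ[F] H)
    (hg : ∀ (i : ℕ) (hi : i + 1 < n - mu 0),
      g (T' (adjT i hi)) = T (adjT (i + mu 0) (by omega)))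
    (wmu : Equiv.Perm (Fin n)) (hwmu : IsWmu mu wmu)
    (wmut : Equiv.Perm (Fin (n - mu 0))) (hwmut : IsWmu (fun s => mu (s+1)) wmut) :
    ∃ h : H, T wmu * yElt q T (conjP mu)
      = g (T' wmut * yElt q T' (conjP (fun s => mu (s+1)))) * h := by
  have hd := hwmu.removesFirsts hmu hwmut
  set d := wmu * (shiftPerm n (mu 0) wmut)⁻¹ with hd_def
  have hw : wmu = d * shiftPerm n (mu 0) wmut := by simp [hd_def]
  have hgT := map_heckeBasis_eq_shiftPerm hT hT' g hg
  obtain ⟨h, hh⟩ := hd.dvd_sum_levelSubgroup hT (-q)⁻¹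
  refine ⟨T d * h, ?_⟩
  have hcomm : T d * ∑ v ∈ Finset.univ.filter (· ∈ levelSubgroup
      fun p : Fin (n - mu 0) => rowOf (conjP fun s => mu (s + 1)) p),
        (-q)⁻¹ ^ permLength v • T (RemovesFirsts.conjShift n (mu 0) d v) =
      g (yElt q T' (conjP fun s => mu (s + 1))) * T d := by
    rw [yElt_eq_sum_levelSubgroup, map_sum, Finset.mul_sum, Finset.sum_mul]
    refine Finset.sum_congr rfl fun v hv => ?_
    simp only [Finset.mem_filter, Finset.mem_univ, true_and] at hv
    rw [map_smul, hgT, mul_smul_comm, smul_mul_assoc,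
      hT.mul_of_inversionsPersist (hd.inversionsPersist_conjShift hv),
      hT.mul_of_inversionsPersist (hd.inversionsPersist_shiftPerm v),
      RemovesFirsts.conjShift_mul]
  rw [yElt_eq_sum_levelSubgroup, hh, map_mul, hgT, hw,
    ← hT.mul_of_inversionsPersist (hd.inversionsPersist_shiftPerm wmut), ← mul_assoc,
    mul_assoc (T (shiftPerm n (mu 0) wmut)), hcomm]
  simp only [mul_assoc]

end FayersSemistd
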